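/- arXiv:2104.15096 — 2 statements merged into one kernel-verified Lean document; each statement's English description precedes it below -/
import Mathlib

section
/- Let α > 0, ε > 0 and v ∈ ℝ with |v| ≤ α + ε. Then the unique minimizer of x ↦ α·B_ε(x) + (1/2)(x − v)² is the soft-thresholded value max(1 − α/|v|, 0)·v (interpreted as 0 when v = 0); equivalently, the minimizer is 0 if |v| ≤ α and is v − α·sign(v) if α < |v| ≤ α + ε. -/
/-- The Berhu regularizer of parameter `ε`. -/
noncomputable def berhu (ε : ℝ) (x : ℝ) : ℝ :=
  if |x| ≤ ε then |x| else (x ^ 2 + ε ^ 2) / (2 * ε)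

theorem abs_le_berhu {ε : ℝ} (hε : 0 < ε) (x : ℝ) : |x| ≤ berhu ε x := by
  unfold berhu
  split_ifs
  · exact le_rfl
  · rw [le_div_iff₀ (by positivity), ← sq_abs x]
    nlinarith [sq_nonneg (|x| - ε)]

theorem berhu_of_abs_le {ε x : ℝ} (hx : |x| ≤ ε) : berhu ε x = |x| :=
  if_pos hx

theorem softThreshold_eq_zero {α v : ℝ} (hv : |v| ≤ α) : max (1 - α / |v|) 0 * v = 0 := by
  rcases eq_or_ne v 0 with rfl | h
  · simp
  · have h1 : 1 ≤ α / |v| := (one_le_div (abs_pos.mpr h)).mpr hv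
    rw [max_eq_right (by linarith), zero_mul]

theorem softThreshold_eq_sub {α v : ℝ} (hα : 0 ≤ α) (hv : α < |v|) :
    max (1 - α / |v|) 0 * v = v - α * Real.sign v := by
  have hpos : 0 < |v| := hα.trans_lt hv
  have h1 : α / |v| ≤ 1 := (div_le_one hpos).mpr hv.le
  rw [max_eq_left (by linarith)]
  rcases lt_or_gt_of_ne (abs_pos.mp hpos) with h | h
  · rw [Real.sign_of_neg h, abs_of_neg h]
    have hne : v ≠ 0 := h.ne
    field_simp
  · rw [Real.sign_of_pos h, abs_of_pos h]
    field_simp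

theorem abs_softThreshold_le {α ε v : ℝ} (hα : 0 ≤ α) (hε : 0 ≤ ε) (hv : |v| ≤ α + ε) :
    |max (1 - α / |v|) 0 * v| ≤ ε := by
  rcases le_or_gt |v| α with h | h
  · simpa [softThreshold_eq_zero h] using hε
  · rw [softThreshold_eq_sub hα h]
    rcases lt_or_gt_of_ne (abs_pos.mp (hα.trans_lt h)) with h0 | h0
    · rw [abs_of_neg h0] at h hv
      rw [Real.sign_of_neg h0, abs_le]
      constructor <;> linarith
    · rw [abs_of_pos h0] at h hv
      rw [Real.sign_of_pos h0, abs_le]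
      constructor <;> linarith

/-- Quadratic growth of `x ↦ α * |x| + (1/2)(x - v)^2` around the soft-thresholded value. -/
theorem softThreshold_quadratic_growth {α : ℝ} (hα : 0 ≤ α) (v y : ℝ) :
    α * |max (1 - α / |v|) 0 * v| + (1 / 2) * (max (1 - α / |v|) 0 * v - v) ^ 2 +
        (1 / 2) * (y - max (1 - α / |v|) 0 * v) ^ 2 ≤
      α * |y| + (1 / 2) * (y - v) ^ 2 := by
  rcases le_or_gt |v| α with h | h
  · rw [softThreshold_eq_zero h, abs_zero]
    have h1 : v * y ≤ α * |y| :=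
      (le_abs_self _).trans (by rw [abs_mul]; gcongr)
    nlinarith
  · rw [softThreshold_eq_sub hα h]
    rcases lt_or_gt_of_ne (abs_pos.mp (hα.trans_lt h)) with h0 | h0
    · rw [abs_of_neg h0] at h
      rw [Real.sign_of_neg h0, abs_of_neg (by linarith : v - α * -1 < 0)]
      nlinarith [mul_le_mul_of_nonneg_left (neg_le_abs y) hα]
    · rw [abs_of_pos h0] at h
      rw [Real.sign_of_pos h0, abs_of_pos (by linarith : 0 < v - α * 1)]
      nlinarith [mul_le_mul_of_nonneg_left (le_abs_self y) hα]

/-- For `α > 0`, `ε > 0` and `|v| ≤ α + ε`, the unique minimizer of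
`x ↦ α * B_ε x + (1/2)(x - v)^2` is the soft-thresholded value `max (1 - α/|v|) 0 * v`
(which is `0` when `v = 0`); equivalently, it is `0` when `|v| ≤ α` and
`v - α * sign v` when `α < |v| ≤ α + ε`. -/
theorem berhu_prox_soft_threshold (α ε v : ℝ) (hα : 0 < α) (hε : 0 < ε)
    (hv : |v| ≤ α + ε) :
    (∀ y : ℝ,
        α * berhu ε (max (1 - α / |v|) 0 * v) +
            (1 / 2) * (max (1 - α / |v|) 0 * v - v) ^ 2 ≤
          α * berhu ε y + (1 / 2) * (y - v) ^ 2) ∧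
    (∀ x : ℝ,
        (∀ y : ℝ, α * berhu ε x + (1 / 2) * (x - v) ^ 2 ≤
            α * berhu ε y + (1 / 2) * (y - v) ^ 2) →
        x = max (1 - α / |v|) 0 * v) ∧
    (v = 0 → max (1 - α / |v|) 0 * v = 0) ∧
    (|v| ≤ α → max (1 - α / |v|) 0 * v = 0) ∧
    (α < |v| → max (1 - α / |v|) 0 * v = v - α * Real.sign v) := by
  have hp := berhu_of_abs_le (abs_softThreshold_le hα.le hε.le hv)
  have hgrowth (y : ℝ) :
      α * berhu ε (max (1 - α / |v|) 0 * v) + (1 / 2) * (max (1 - α / |v|) 0 * v - v) ^ 2 +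
          (1 / 2) * (y - max (1 - α / |v|) 0 * v) ^ 2 ≤
        α * berhu ε y + (1 / 2) * (y - v) ^ 2 := by
    rw [hp]
    linarith [softThreshold_quadratic_growth hα.le v y,
      mul_le_mul_of_nonneg_left (abs_le_berhu hε y) hα.le]
  refine ⟨fun y ↦ ?_, fun x hx ↦ ?_, ?_, softThreshold_eq_zero, softThreshold_eq_sub hα.le⟩
  · linarith [hgrowth y, sq_nonneg (y - max (1 - α / |v|) 0 * v)]
  · have hle : (x - max (1 - α / |v|) 0 * v) ^ 2 ≤ 0 := by
      linarith [hgrowth x, hx (max (1 - α / |v|) 0 * v)]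
    exact sub_eq_zero.mp (pow_eq_zero_iff two_ne_zero |>.mp (hle.antisymm (sq_nonneg _)))
  · rintro rfl
    exact mul_zero _
end

section
/- Let α > 0, ε > 0 and v ∈ ℝ with |v| > α + ε. Then the unique minimizer of x ↦ α·B_ε(x) + (1/2)(x − v)² is the linearly shrunk value (ε/(α + ε))·v, and this minimizer x* satisfies |x*| > ε (so it lies in the quadratic branch of B_ε). -/
/-- For `ε < |p|`, the slope `p / ε` is a subgradient of the Berhu regularizer at `p`. -/
theorem berhu_add_slope_mul_sub_le {ε p : ℝ} (hε : 0 < ε) (hp : ε < |p|) (y : ℝ) :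
    berhu ε p + p / ε * (y - p) ≤ berhu ε y := by
  have h_left : berhu ε p + p / ε * (y - p) = (ε ^ 2 - p ^ 2 + 2 * (p * y)) / (2 * ε) := by
    rw [berhu, if_neg (not_le.mpr hp)]
    field_simp
    ring
  rw [h_left, div_le_iff₀ (by positivity), berhu]
  split_ifs with hy
  · have h_prod : p * y ≤ |p| * |y| := (le_abs_self _).trans (abs_mul p y).le
    have h_gap : 0 ≤ (|p| - ε) * (|p| + ε - 2 * |y|) :=
      mul_nonneg (by linarith) (by linarith)
    nlinarith [sq_abs p]
  · rw [div_mul_cancel₀ _ (by positivity)]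
    nlinarith [sq_nonneg (y - p)]

/-- For `α > 0`, `ε > 0` and `|v| > α + ε`, the unique minimizer of
`x ↦ α * B_ε x + (1/2)(x - v)^2` is the linearly shrunk value `(ε / (α + ε)) * v`,
and this minimizer `x*` satisfies `|x*| > ε`, so it lies in the quadratic branch
of `B_ε`. -/
theorem berhu_prox_linear_shrinkage (α ε v : ℝ) (hα : 0 < α) (hε : 0 < ε)
    (hv : α + ε < |v|) :
    (∀ y : ℝ,
        α * berhu ε ((ε / (α + ε)) * v) + (1 / 2) * ((ε / (α + ε)) * v - v) ^ 2 ≤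
          α * berhu ε y + (1 / 2) * (y - v) ^ 2) ∧
    (∀ x : ℝ,
        (∀ y : ℝ, α * berhu ε x + (1 / 2) * (x - v) ^ 2 ≤
            α * berhu ε y + (1 / 2) * (y - v) ^ 2) →
        x = (ε / (α + ε)) * v) ∧
    ε < |(ε / (α + ε)) * v| := by
  have hs : 0 < α + ε := by positivity
  set p := ε / (α + ε) * v with hp_def
  have hp : ε < |p| := by
    rw [hp_def, abs_mul, abs_of_pos (div_pos hε hs), div_mul_eq_mul_div, lt_div_iff₀ hs]
    exact mul_lt_mul_of_pos_left hv hε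
  have h_slope : α * (p / ε) = v - p := by
    rw [hp_def]
    field_simp
    ring
  have h_growth (y : ℝ) : α * berhu ε p + (1 / 2) * (p - v) ^ 2 + (1 / 2) * (y - p) ^ 2 ≤
      α * berhu ε y + (1 / 2) * (y - v) ^ 2 := by
    have h := mul_le_mul_of_nonneg_left (berhu_add_slope_mul_sub_le hε hp y) hα.le
    rw [mul_add, ← mul_assoc, h_slope] at h
    linarith
  refine ⟨fun y => ?_, fun x hx => ?_, hp⟩
  · linarith [h_growth y, sq_nonneg (y - p)]
  · have h_sq : (x - p) ^ 2 = 0 :=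
      le_antisymm (by linarith [h_growth x, hx p]) (sq_nonneg _)
    exact sub_eq_zero.mp (pow_eq_zero_iff two_ne_zero |>.mp h_sq)
end
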